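/- arXiv:2207.10557 — 7 statements merged into one kernel-verified Lean document; each statement's English description precedes it below -/
import Mathlib

section
/- Assume the principle ω^ω-cohere holds. Suppose F : Set ℕ → Set ℕ induces an automorphism of P(ω)/fin and triv(F) is a proper dense ideal (ℕ ∉ triv(F), and every infinite subset of ℕ has an infinite subset in triv(F)). Let ⟨a_n : n ∈ ℕ⟩ be a ⊆*-increasing sequence of subsets of ℕ. Then either there is an n with ℕ \ a_n ∈ triv(F), or there is an infinite set b ⊆ ℕ with b ∉ triv(F) such that b ∩ a_n is finite for every n. -/
/-- `x =* y`: the symmetric difference of `x` and `y` is finite. -/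
def EqStar (x y : Set ℕ) : Prop := ((x \ y) ∪ (y \ x)).Finite

/-- `F` induces an automorphism of `P(ω)/fin`. -/
def InducesAuto (F : Set ℕ → Set ℕ) : Prop :=
  (∀ x y : Set ℕ, EqStar x y → EqStar (F x) (F y)) ∧
  (∀ x y : Set ℕ, EqStar (F (x ∪ y)) (F x ∪ F y)) ∧
  (∀ x : Set ℕ, EqStar (F xᶜ) (F x)ᶜ) ∧
  (∀ x y : Set ℕ, EqStar (F x) (F y) → EqStar x y) ∧
  (∀ y : Set ℕ, ∃ x : Set ℕ, EqStar (F x) y)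

/-- `triv F`: the sets on which `F` is trivial. -/
def Triv (F : Set ℕ → Set ℕ) : Set (Set ℕ) :=
  {a | ∃ h : ℕ → ℕ, Set.InjOn h a ∧ ∀ x : Set ℕ, x ⊆ a → EqStar (F x) (h '' x)}

/-- `f^↓ = {(n,m) : m < f n}`. -/
def downSet (f : ℕ → ℕ) : Set (ℕ × ℕ) := {p | p.2 < f p.1}

/-- The principle ω^ω-cohere. -/
def OmegaCohere : Prop :=
  ∀ H : (ℕ → ℕ) → (ℕ × ℕ → ℕ),
    (∀ f g : ℕ → ℕ, {p ∈ downSet f ∩ downSet g | H f p ≠ H g p}.Finite) →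
    ∃ h : ℕ × ℕ → ℕ, ∀ f : ℕ → ℕ, {p ∈ downSet f | h p ≠ H f p}.Finite

open Filter

theorem eqStar_iff {x y : Set ℕ} :
    EqStar x y ↔ ∀ᶠ k in cofinite, (k ∈ x ↔ k ∈ y) := by
  rw [EqStar, eventually_cofinite]
  have : (x \ y) ∪ (y \ x) = {k | ¬(k ∈ x ↔ k ∈ y)} := by
    ext k
    simp only [Set.mem_union, Set.mem_sdiff, Set.mem_ofPred_eq]
    tauto
  rw [this]

/-- Functions agreeing at all but finitely many points of `x` have almost equal images of `x`. -/
theorem eqStar_image_of_finite_ne {g h : ℕ → ℕ} {x : Set ℕ}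
    (hfin : {k ∈ x | g k ≠ h k}.Finite) : EqStar (g '' x) (h '' x) := by
  refine ((hfin.image g).union (hfin.image h)).subset ?_
  rintro j (⟨⟨k, hk, rfl⟩, hj⟩ | ⟨⟨k, hk, rfl⟩, hj⟩)
  · exact Or.inl ⟨k, ⟨hk, fun e => hj ⟨k, hk, e.symm⟩⟩, rfl⟩
  · exact Or.inr ⟨k, ⟨hk, fun e => hj ⟨k, hk, e⟩⟩, rfl⟩

theorem finite_of_eventually_notMem {s : Set ℕ} (hs : ∀ᶠ k in cofinite, k ∉ s) : s.Finite :=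
  (eventually_cofinite.1 hs).subset fun _ hk => not_not.2 hk

theorem eventually_cofinite_comp_of_injOn {h : ℕ → ℕ} {S : Set ℕ} (hS : Set.InjOn h S)
    {P : ℕ → Prop} (hP : ∀ᶠ j in cofinite, P j) : ∀ᶠ k in cofinite, k ∈ S → P (h k) := by
  rw [eventually_cofinite] at hP ⊢
  refine Set.Finite.of_finite_image (f := h) (hP.subset ?_) (hS.mono ?_)
  · rintro _ ⟨k, hk, rfl⟩
    simp only [Set.mem_ofPred_eq, Classical.not_imp] at hk
    exact hk.2
  · intro k hk
    simp only [Set.mem_ofPred_eq, Classical.not_imp] at hk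
    exact hk.1

/-- Two injections with almost equal images on every subset of `b` agree almost everywhere
on `b`. -/
theorem finite_ne_of_forall_eqStar_image {g h : ℕ → ℕ} {b : Set ℕ} (hg : Set.InjOn g b)
    (hh : Set.InjOn h b) (hgh : ∀ x ⊆ b, EqStar (g '' x) (h '' x)) :
    {k ∈ b | g k ≠ h k}.Finite := by
  by_contra hinf
  change Set.Infinite _ at hinf
  obtain ⟨f, hfP, hfr⟩ := exists_seq_of_forall_finset_exists
    (fun k => k ∈ {k ∈ b | g k ≠ h k}) (fun k l => k ≠ l ∧ g k ≠ h l ∧ g l ≠ h k) (by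
      intro s _
      have hpre : ∀ u v : ℕ → ℕ, Set.InjOn u b → (b ∩ u ⁻¹' (v '' (s : Set ℕ))).Finite :=
        fun u v hu => Set.Finite.of_finite_image (f := u) ((s.finite_toSet.image v).subset
          (by rintro _ ⟨k, hk, rfl⟩; exact hk.2)) (hu.mono Set.inter_subset_left)
      have h1 := hpre g h hg
      have h2 := hpre h g hh
      obtain ⟨l, hl, hl'⟩ := (hinf.sdiff ((s.finite_toSet.union h1).union h2)).nonempty
      refine ⟨l, hl, fun k hk => ⟨?_, ?_, ?_⟩⟩
      · rintro rfl
        exact hl' (Or.inl (Or.inl hk))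
      · intro e
        exact hl' (Or.inr ⟨hl.1, k, hk, e⟩)
      · intro e
        exact hl' (Or.inl (Or.inr ⟨hl.1, k, hk, e.symm⟩)))
  have hsub : Set.range f ⊆ b := by
    rintro _ ⟨i, rfl⟩
    exact (hfP i).1
  have hne : ∀ i j, g (f i) ≠ h (f j) := by
    intro i j
    rcases lt_trichotomy i j with hij | rfl | hij
    · exact (hfr i j hij).2.1
    · exact (hfP i).2
    · exact (hfr j i hij).2.2
  have hfinj : Function.Injective f := by
    intro i j e
    rcases lt_trichotomy i j with hij | rfl | hij
    · exact absurd e (hfr i j hij).1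
    · rfl
    · exact absurd e.symm (hfr j i hij).1
  refine ((Set.infinite_range_of_injective hfinj).image (hg.mono hsub))
    ((hgh _ hsub).subset ?_)
  rintro _ ⟨_, ⟨i, rfl⟩, rfl⟩
  refine Or.inl ⟨⟨_, ⟨i, rfl⟩, rfl⟩, ?_⟩
  rintro ⟨_, ⟨j, rfl⟩, e⟩
  exact hne i j e.symm

theorem exists_disjoint_infinite_subsets {L : Set ℕ} (hL : L.Infinite) :
    ∃ A ⊆ L, ∃ B ⊆ L, A.Infinite ∧ B.Infinite ∧ Disjoint A B := by
  let e := hL.natEmbedding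
  have he : Function.Injective fun i => (e i : ℕ) := Subtype.val_injective.comp e.injective
  refine ⟨Set.range fun i => (e (2 * i) : ℕ), ?_, Set.range fun i => (e (2 * i + 1) : ℕ), ?_,
    ?_, ?_, ?_⟩
  · rintro _ ⟨i, rfl⟩
    exact (e _).2
  · rintro _ ⟨i, rfl⟩
    exact (e _).2
  · exact Set.infinite_range_of_injective fun i j hij => by
      have := he hij
      omega
  · exact Set.infinite_range_of_injective fun i j hij => by
      have := he hij
      omega
  · rw [Set.disjoint_left]
    rintro _ ⟨i, rfl⟩ ⟨j, hj⟩
    have := he hj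
    omega

/-- `G` maps unions to almost unions and disjoint sets to almost disjoint ones. -/
structure IsAlmostHom (G : Set ℕ → Set ℕ) : Prop where
  union : ∀ x y, ∀ᶠ k in cofinite, (k ∈ G (x ∪ y) ↔ k ∈ G x ∨ k ∈ G y)
  disjoint : ∀ x y, Disjoint x y → ∀ᶠ k in cofinite, ¬(k ∈ G x ∧ k ∈ G y)

namespace IsAlmostHom

variable {G : Set ℕ → Set ℕ}

theorem mono (hG : IsAlmostHom G) {x y : Set ℕ} (hxy : x ⊆ y) :
    ∀ᶠ k in cofinite, k ∈ G x → k ∈ G y := by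
  filter_upwards [hG.union x y] with k hk hx
  rw [Set.union_eq_self_of_subset_left hxy] at hk
  exact hk.2 (Or.inl hx)

theorem empty (hG : IsAlmostHom G) : ∀ᶠ k in cofinite, k ∉ G ∅ := by
  filter_upwards [hG.disjoint ∅ ∅ (Set.disjoint_empty _)] with k hk hk'
  exact hk ⟨hk', hk'⟩

/-- Let `Y` be a sequence of disjoint infinite sets, each almost disjoint from the `G`-images of
itself and its predecessors. For some index set `J`, the set `G (⋃ j ∈ J, Y j)` omits infinitely
many points of `Y i` for infinitely many `i ∈ J`. -/
theorem exists_index_set (hG : IsAlmostHom G) {Y : ℕ → Set ℕ} (hinf : ∀ i, (Y i).Infinite)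
    (hdisj : Pairwise fun i j => Disjoint (Y i) (Y j))
    (hpre : ∀ j i, j ≤ i → ∀ᶠ k in cofinite, k ∈ Y i → k ∉ G (Y j)) :
    ∃ J : Set ℕ, ∀ n, ∃ i ∈ J, n ≤ i ∧ ∃ᶠ k in cofinite, k ∈ Y i ∧ k ∉ G (⋃ j ∈ J, Y j) := by
  have hsplit : ∀ (L : {L : Set ℕ // L.Infinite}) (i : ℕ), ∃ L' : {L : Set ℕ // L.Infinite},
      L'.1 ⊆ L.1 ∧ (∀ j ∈ L'.1, i < j) ∧
        ∃ᶠ k in cofinite, k ∈ Y i ∧ k ∉ G (⋃ j ∈ L'.1, Y j) := by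
    rintro ⟨L, hL⟩ i
    obtain ⟨A, hA, B, hB, hAi, hBi, hAB⟩ :=
      exists_disjoint_infinite_subsets (hL.sdiff (Set.finite_Iic i))
    by_contra! hcon
    have key : ∀ C ⊆ L \ Set.Iic i, C.Infinite →
        ∀ᶠ k in cofinite, k ∈ Y i → k ∈ G (⋃ j ∈ C, Y j) := by
      intro C hC hCi
      have := hcon ⟨C, hCi⟩ (hC.trans Set.sdiff_subset) (fun j hj => by simpa using (hC hj).2)
      simpa using this
    have hdis : Disjoint (⋃ j ∈ A, Y j) (⋃ j ∈ B, Y j) := by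
      simp only [Set.disjoint_iUnion_left, Set.disjoint_iUnion_right]
      intro b hb a ha
      exact hdisj (ne_of_mem_of_not_mem ha (Set.disjoint_right.1 hAB hb))
    refine hinf i ?_
    have : ∀ᶠ k in cofinite, k ∉ Y i := by
      filter_upwards [key A hA hAi, key B hB hBi, hG.disjoint _ _ hdis] with k h1 h2 h3 hk
      exact h3 ⟨h1 hk, h2 hk⟩
    exact finite_of_eventually_notMem this
  have hpre' : ∀ i q, q ≤ i + 1 → ∀ᶠ k in cofinite, k ∈ Y i → k ∉ G (⋃ j ∈ Set.Iio q, Y j) := by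
    intro i q
    induction q with
    | zero =>
      intro _
      filter_upwards [hG.empty] with k hk _
      simpa using hk
    | succ q ih =>
      intro hq
      have hu : (⋃ j ∈ Set.Iio (q + 1), Y j) = (⋃ j ∈ Set.Iio q, Y j) ∪ Y q := by
        rw [← Order.succ_eq_add_one, Order.Iio_succ_eq_insert, Set.biUnion_insert, Set.union_comm]
      rw [hu]
      filter_upwards [ih (by omega), hpre q i (by omega), hG.union (⋃ j ∈ Set.Iio q, Y j) (Y q)]
        with k h1 h2 h3 hk h4
      exact (h3.1 h4).elim (h1 hk) (h2 hk)
  choose next hsub hlt hfreq using hsplit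
  let L : ℕ → {L : Set ℕ // L.Infinite} := fun t =>
    Nat.rec ⟨Set.univ, Set.infinite_univ⟩ (fun _ L => next L L.2.nonempty.some) t
  let f : ℕ → ℕ := fun t => (L t).2.nonempty.some
  have hfL : ∀ t, f t ∈ (L t).1 := fun t => (L t).2.nonempty.some_mem
  have hL : ∀ t, L (t + 1) = next (L t) (f t) := fun _ => rfl
  have hanti : Antitone fun t => (L t).1 := antitone_nat_of_succ_le fun t => by
    change (L (t + 1)).1 ⊆ _
    rw [hL]
    exact hsub _ _
  have hmono : StrictMono f := strictMono_nat_of_lt_succ fun t =>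
    hlt (L t) (f t) _ (hL t ▸ hfL (t + 1))
  refine ⟨Set.range f, fun n => ⟨f n, ⟨n, rfl⟩, hmono.id_le n, ?_⟩⟩
  have hcover : (⋃ j ∈ Set.range f, Y j) ⊆
      (⋃ j ∈ Set.Iio (f n + 1), Y j) ∪ ⋃ j ∈ (L (n + 1)).1, Y j := by
    simp only [Set.iUnion_subset_iff]
    rintro _ ⟨s, rfl⟩
    rcases le_or_gt s n with hs | hs
    · exact (Set.subset_biUnion_of_mem (u := Y)
        (Set.mem_Iio.2 (Nat.lt_succ_of_le (hmono.monotone hs)))).trans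
          Set.subset_union_left
    · exact (Set.subset_biUnion_of_mem (u := Y) (hanti hs (hfL s))).trans Set.subset_union_right
  have h4 := hfreq (L n) (f n)
  rw [← hL] at h4
  refine (h4.and_eventually <| (hG.mono hcover).and <|
    (hG.union (⋃ j ∈ Set.Iio (f n + 1), Y j) (⋃ j ∈ (L (n + 1)).1, Y j)).and
      (hpre' (f n) (f n + 1) le_rfl)).mono ?_
  rintro k ⟨⟨hk, h1⟩, h2, h3, h5⟩
  exact ⟨hk, fun h6 => (h3.1 (h2 h6)).elim (h5 hk) h1⟩

/-- If every set is fixed by `G` modulo some level of `ρ`, then a single level works for all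
sets. -/
theorem exists_uniform_level (hG : IsAlmostHom G) {ρ : ℕ → ℕ}
    (hfix : ∀ V, ∃ n, ∀ᶠ k in cofinite, n < ρ k → (k ∈ V ↔ k ∈ G V)) :
    ∃ n, ∀ V, ∀ᶠ k in cofinite, n < ρ k → k ∈ V → k ∈ G V := by
  by_contra! hcon
  have hstep : ∀ n, ∃ m, ∃ y : Set ℕ, y.Infinite ∧ (∀ k ∈ y, n < ρ k ∧ ρ k ≤ m) ∧
      ∀ᶠ k in cofinite, k ∈ G y → k ∉ y ∧ ρ k ≤ m := by
    intro n
    obtain ⟨V, hV⟩ := hcon n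
    set y : Set ℕ := {k | n < ρ k ∧ k ∈ V ∧ k ∉ G V} with hy
    have hyV : y ⊆ V := fun k hk => hk.2.1
    have hyinf : y.Infinite := by
      exact frequently_cofinite_iff_infinite.1 hV
    obtain ⟨m, hm⟩ := hfix y
    have hout : ∀ᶠ k in cofinite, k ∈ y → ρ k ≤ m := by
      filter_upwards [hm, hG.mono hyV] with k h1 h2 hk
      by_contra! hlt
      exact hk.2.2 (h2 ((h1 hlt).1 hk))
    refine ⟨m, y ∩ {k | ρ k ≤ m}, ?_, fun k hk => ⟨hk.1.1, hk.2⟩, ?_⟩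
    · exact frequently_cofinite_iff_infinite.1 <|
        ((frequently_cofinite_iff_infinite.2 hyinf).and_eventually hout).mono
          fun k hk => ⟨hk.1, hk.2 hk.1⟩
    · filter_upwards [hm, hG.mono hyV, hG.mono (x := y ∩ {k | ρ k ≤ m}) Set.inter_subset_left,
        hout] with k h1 h2 h3 h4 hk
      refine ⟨fun h5 => h5.1.2.2 (h2 (h3 hk)), ?_⟩
      by_contra! hlt
      exact absurd (h4 ((h1 hlt).2 (h3 hk))) (not_le.2 hlt)
  choose m y hinf hloc hGy using hstep
  let N : ℕ → ℕ := fun i => m^[i] 0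
  have hN : ∀ i, N (i + 1) = m (N i) := fun i => Function.iterate_succ_apply' m i 0
  have hNmono : StrictMono N := strictMono_nat_of_lt_succ fun i => by
    obtain ⟨k, hk⟩ := (hinf (N i)).nonempty
    rw [hN]
    exact (hloc _ k hk).1.trans_le (hloc _ k hk).2
  have hsep : ∀ i j, i < j → ∀ k ∈ y (N i), k ∉ y (N j) := by
    intro i j hij k hk hk'
    have h1 := (hloc _ k hk).2
    have h2 := (hloc _ k hk').1
    have h3 := hNmono.monotone (Nat.succ_le_of_lt hij)
    rw [Nat.succ_eq_add_one, hN] at h3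
    omega
  obtain ⟨J, hJ⟩ := hG.exists_index_set (Y := fun i => y (N i)) (fun i => hinf _)
    (by
      intro i j hij
      refine Set.disjoint_left.2 fun k hk hk' => ?_
      rcases lt_or_gt_of_ne hij with h | h
      · exact hsep i j h k hk hk'
      · exact hsep j i h k hk' hk)
    (by
      intro j i hji
      filter_upwards [hGy (N j)] with k hk hki hkj
      obtain ⟨h1, h2⟩ := hk hkj
      rcases hji.eq_or_lt with rfl | hlt
      · exact h1 hki
      · have h3 := hNmono.monotone (Nat.succ_le_of_lt hlt)
        rw [Nat.succ_eq_add_one, hN] at h3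
        have := (hloc _ k hki).1
        omega)
  obtain ⟨n, hn⟩ := hfix (⋃ j ∈ J, y (N j))
  obtain ⟨i, hi, hni, hfreq⟩ := hJ n
  obtain ⟨k, ⟨hk, hk'⟩, hk2⟩ := (hfreq.and_eventually hn).exists
  refine hk' ((hk2 ?_).1 (Set.mem_biUnion hi hk))
  exact (hni.trans (hNmono.id_le i)).trans_lt (hloc _ k hk).1

end IsAlmostHom

/-- Local trivializations on the sets that are finite below each level of `ρ` glue to a single
function. -/
theorem OmegaCohere.exists_glued (hω : OmegaCohere) {F : Set ℕ → Set ℕ}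
    {ρ : ℕ → ℕ}
    (htriv : ∀ b : Set ℕ, (∀ n, {k ∈ b | ρ k ≤ n}.Finite) → b ∈ Triv F) :
    ∃ h : ℕ → ℕ, ∀ b : Set ℕ, (∀ n, {k ∈ b | ρ k ≤ n}.Finite) →
      (∀ x ⊆ b, EqStar (F x) (h '' x)) ∧ ∃ E : Set ℕ, E.Finite ∧ Set.InjOn h (b \ E) := by
  classical
  let B : (ℕ → ℕ) → Set ℕ := fun f => {k | k < f (ρ k)}
  have hB : ∀ f, B f ∈ Triv F := by
    refine fun f => htriv _ fun n => ?_
    refine ((Set.finite_Iic n).biUnion fun i _ => Set.finite_Iio (f i)).subset ?_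
    rintro k ⟨hk, hkn⟩
    exact Set.mem_biUnion hkn hk
  choose g hginj hg using hB
  obtain ⟨h, hh⟩ := hω (fun f p => if p.1 = ρ p.2 then g f p.2 else 0) (by
    intro f f'
    have hfin : {k ∈ B f ∩ B f' | g f k ≠ g f' k}.Finite := by
      refine finite_ne_of_forall_eqStar_image ((hginj f).mono Set.inter_subset_left)
        ((hginj f').mono Set.inter_subset_right) fun x hx => ?_
      have h1 := eqStar_iff.1 (hg f x (hx.trans Set.inter_subset_left))
      have h2 := eqStar_iff.1 (hg f' x (hx.trans Set.inter_subset_right))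
      rw [eqStar_iff]
      filter_upwards [h1, h2] with k h3 h4
      rw [← h3, h4]
    refine (hfin.image fun k => (ρ k, k)).subset ?_
    rintro ⟨n, k⟩ ⟨⟨h1, h2⟩, h3⟩
    by_cases hn : n = ρ k
    · subst hn
      exact ⟨k, ⟨⟨h1, h2⟩, by simpa using h3⟩, rfl⟩
    · simp [hn] at h3)
  refine ⟨fun k => h (ρ k, k), fun b hb => ?_⟩
  obtain ⟨f, hf⟩ : ∃ f : ℕ → ℕ, b ⊆ B f := by
    choose u hu using fun n => (hb n).bddAbove
    exact ⟨fun n => u n + 1, fun k hk => Nat.lt_succ_of_le (hu (ρ k) ⟨hk, le_rfl⟩)⟩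
  have hfin : {k ∈ B f | h (ρ k, k) ≠ g f k}.Finite := by
    refine Set.Finite.of_finite_image (f := fun k => (ρ k, k)) ((hh f).subset ?_)
      (fun k _ l _ e => congrArg Prod.snd e)
    rintro _ ⟨k, ⟨h1, h2⟩, rfl⟩
    exact ⟨h1, by simpa using h2⟩
  refine ⟨fun x hx => ?_, _, hfin, fun k hk l hl e => ?_⟩
  · have h1 := eqStar_iff.1 (hg f x (hx.trans hf))
    have h2 := eqStar_iff.1 (eqStar_image_of_finite_ne (x := x)
      (hfin.subset fun k hk => ⟨hf (hx hk.1), hk.2⟩))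
    rw [eqStar_iff]
    filter_upwards [h1, h2] with k h3 h4
    rw [h3, h4]
  · have key : ∀ k ∈ b \ {k ∈ B f | h (ρ k, k) ≠ g f k}, h (ρ k, k) = g f k := fun k hk =>
      by_contra fun hne => hk.2 ⟨hf hk.1, hne⟩
    refine hginj f (hf hk.1) (hf hl.1) ?_
    rw [← key k hk, ← key l hl]
    exact e

namespace InducesAuto

variable {F : Set ℕ → Set ℕ}

theorem congr (hF : InducesAuto F) {x y : Set ℕ} (hxy : EqStar x y) : EqStar (F x) (F y) :=
  hF.1 x y hxy

theorem isAlmostHom (hF : InducesAuto F) : IsAlmostHom F := by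
  have hu : ∀ x y, ∀ᶠ k in cofinite, (k ∈ F (x ∪ y) ↔ k ∈ F x ∨ k ∈ F y) :=
    fun x y => eqStar_iff.1 (hF.2.1 x y)
  refine ⟨hu, fun x y hxy => ?_⟩
  filter_upwards [eqStar_iff.1 (hF.2.2.1 x), hu y xᶜ] with k h1 h2 h3
  rw [Set.union_eq_self_of_subset_left (Set.subset_compl_iff_disjoint_left.2 hxy)] at h2
  exact (h1.1 (h2.2 (Or.inl h3.2))) h3.1

theorem finite_of_finite (hF : InducesAuto F) {x : Set ℕ} (hx : (F x).Finite) : x.Finite := by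
  have h : EqStar x ∅ := hF.2.2.2.1 _ _ (eqStar_iff.2 (by
    filter_upwards [hF.isAlmostHom.empty, hx.compl_mem_cofinite] with k h1 h2
    exact iff_of_false h2 h1))
  simpa [EqStar] using h

theorem mem_triv_of_finite (hF : InducesAuto F) {b : Set ℕ} (hb : b.Finite) : b ∈ Triv F := by
  refine ⟨id, Function.injective_id.injOn, fun x hx => ?_⟩
  have hxf := hb.subset hx
  have h1 : EqStar (F x) (F ∅) := hF.congr (by simpa [EqStar] using hxf)
  rw [eqStar_iff] at h1 ⊢
  filter_upwards [h1, hF.isAlmostHom.empty, hxf.compl_mem_cofinite] with k h2 h3 h4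
  simp only [Set.image_id]
  exact iff_of_false (fun h => h3 (h2.1 h)) h4

/-- An injection which almost maps `x` into `F x` for all subsets `x` of `s` induces `F` on `s`. -/
theorem eqStar_image_of_almost_subset (hF : InducesAuto F) {h : ℕ → ℕ} {s : Set ℕ}
    (hinj : Set.InjOn h s)
    (hsub : ∀ x ⊆ s, ∀ᶠ k in cofinite, k ∈ x → h k ∈ F x) {x : Set ℕ} (hx : x ⊆ s) :
    EqStar (F x) (h '' x) := by
  have hfin : (F x \ h '' x).Finite := by
    obtain ⟨w, hw⟩ := hF.2.2.2.2 (F x \ h '' x)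
    rw [eqStar_iff] at hw
    have hGw := hF.isAlmostHom.mono (x := w ∩ x) (y := w) Set.inter_subset_left
    have hwx : (w ∩ x).Finite := by
      have h1 := hsub (w ∩ x) (Set.inter_subset_right.trans hx)
      have h2 := eventually_cofinite_comp_of_injOn hinj (hw.and hGw)
      have : ∀ᶠ k in cofinite, k ∉ w ∩ x := by
        filter_upwards [h1, h2] with k h3 h4 hk
        obtain ⟨h5, h6⟩ := h4 (hx hk.2)
        exact (h5.1 (h6 (h3 hk))).2 ⟨k, hk.2, rfl⟩
      exact finite_of_eventually_notMem this
    have hwd : EqStar w (w \ x) := by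
      refine hwx.subset ?_
      rintro k (⟨h1, h2⟩ | ⟨h1, h2⟩)
      · exact ⟨h1, by_contra fun h3 => h2 ⟨h1, h3⟩⟩
      · exact absurd h1.1 h2
    have : ∀ᶠ k in cofinite, k ∉ F x \ h '' x := by
      filter_upwards [hw, eqStar_iff.1 (hF.congr hwd),
        hF.isAlmostHom.disjoint (w \ x) x Set.disjoint_sdiff_left] with k h1 h2 h3 h4
      exact h3 ⟨h2.1 (h1.2 h4), h4.1⟩
    exact finite_of_eventually_notMem this
  refine (hfin.union ((eventually_cofinite.1 (hsub x hx)).image h)).subset ?_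
  rintro j (hj | ⟨⟨k, hk, rfl⟩, hj⟩)
  · exact Or.inl hj
  · exact Or.inr ⟨k, by simpa using ⟨hk, hj⟩, rfl⟩

/-- A set with infinite complement is in `Triv F` as soon as it is almost contained in a set
in `Triv F`. -/
theorem mem_triv_of_almost_subset (hF : InducesAuto F) {s t : Set ℕ} (ht : t ∈ Triv F)
    (hst : (s \ t).Finite)
    (hs : sᶜ.Infinite) : s ∈ Triv F := by
  classical
  obtain ⟨h, hinj, hh⟩ := ht
  have hroom : (h '' (s ∩ t))ᶜ.Infinite := by
    intro hfin
    refine hs (hF.finite_of_finite ?_)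
    have : ∀ᶠ k in cofinite, k ∉ F sᶜ := by
      filter_upwards [hfin.compl_mem_cofinite, eqStar_iff.1 (hh (s ∩ t) Set.inter_subset_right),
        hF.isAlmostHom.disjoint sᶜ (s ∩ t)
          (Set.disjoint_left.2 fun k h1 h2 => h1 h2.1)] with k h1 h2 h3 h4
      exact h3 ⟨h4, h2.2 (not_not.1 h1)⟩
    exact finite_of_eventually_notMem this
  obtain ⟨u, huinj, hu⟩ : ∃ u : ℕ → ℕ, Function.Injective u ∧ ∀ k, u k ∉ h '' (s ∩ t) :=
    ⟨fun k => hroom.natEmbedding _ k, Subtype.val_injective.comp (hroom.natEmbedding _).injective,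
      fun k => (hroom.natEmbedding _ k).2⟩
  refine ⟨fun k => if k ∈ t then h k else u k, ?_, fun x hx => ?_⟩
  · intro k hk l hl e
    by_cases hkt : k ∈ t <;> by_cases hlt : l ∈ t <;> simp only [hkt, hlt, if_true, if_false] at e
    · exact hinj hkt hlt e
    · exact absurd ⟨k, ⟨hk, hkt⟩, e⟩ (hu l)
    · exact absurd ⟨l, ⟨hl, hlt⟩, e.symm⟩ (hu k)
    · exact huinj e
  · have hfin : (x \ t).Finite := hst.subset (Set.sdiff_subset_sdiff_left hx)
    have h1 : EqStar x (x ∩ t) := by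
      refine hfin.subset ?_
      rintro k (⟨h1, h2⟩ | ⟨h1, h2⟩)
      · exact ⟨h1, fun h3 => h2 ⟨h1, h3⟩⟩
      · exact absurd h1.1 h2
    have h2 : EqStar (h '' x) (h '' (x ∩ t)) := by
      refine (hfin.image h).subset ?_
      rintro j (⟨⟨k, hk, rfl⟩, h2⟩ | ⟨⟨k, hk, rfl⟩, h2⟩)
      · exact ⟨k, ⟨hk, fun h3 => h2 ⟨k, ⟨hk, h3⟩, rfl⟩⟩, rfl⟩
      · exact absurd ⟨k, hk.1, rfl⟩ h2
    have h3 : EqStar ((fun k => if k ∈ t then h k else u k) '' x) (h '' x) :=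
      eqStar_image_of_finite_ne (hfin.subset fun k hk => ⟨hk.1, fun hkt => hk.2 (if_pos hkt)⟩)
    rw [eqStar_iff] at h2 h3 ⊢
    filter_upwards [eqStar_iff.1 (hF.congr h1), h2, h3,
      eqStar_iff.1 (hh (x ∩ t) Set.inter_subset_right)] with k h4 h5 h6 h7
    rw [h4, h7, ← h5, ← h6]

/-- If `F` is trivial on every set that is finite below each level of `ρ`, then it is trivial on
some `{k | n < ρ k}`. -/
theorem exists_level_mem_triv (hF : InducesAuto F) (hω : OmegaCohere) {ρ : ℕ → ℕ}
    (htriv : ∀ b : Set ℕ, (∀ n, {k ∈ b | ρ k ≤ n}.Finite) → b ∈ Triv F) :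
    ∃ n, {k | n < ρ k} ∈ Triv F := by
  obtain ⟨h, hh⟩ := hω.exists_glued htriv
  obtain ⟨n₀, hinj⟩ : ∃ n, Set.InjOn h {k | n < ρ k} := by
    by_contra! hcon
    obtain ⟨p, hpP, hpr⟩ := exists_seq_of_forall_finset_exists
      (fun p : ℕ × ℕ => p.1 ≠ p.2 ∧ h p.1 = h p.2)
      (fun p q => max (ρ p.1) (ρ p.2) < min (ρ q.1) (ρ q.2)) (by
        intro s _
        obtain ⟨k, hk, l, hl, e, hne⟩ : ∃ k, s.sup (fun p => max (ρ p.1) (ρ p.2)) < ρ k ∧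
            ∃ l, s.sup (fun p => max (ρ p.1) (ρ p.2)) < ρ l ∧ h k = h l ∧ k ≠ l := by
          have := hcon (s.sup fun p => max (ρ p.1) (ρ p.2))
          simpa [Set.InjOn] using this
        exact ⟨(k, l), ⟨hne, e⟩, fun q hq =>
          (Finset.le_sup (f := fun p : ℕ × ℕ => max (ρ p.1) (ρ p.2)) hq).trans_lt
            (lt_min hk hl)⟩)
    have hmin : StrictMono fun i => min (ρ (p i).1) (ρ (p i).2) := fun i j hij =>
      (min_le_max).trans_lt (hpr i j hij)
    have hle : ∀ i, i ≤ min (ρ (p i).1) (ρ (p i).2) := hmin.id_le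
    obtain ⟨-, E, hE, hEinj⟩ := hh {k | ∃ i, k = (p i).1 ∨ k = (p i).2} (by
      intro n
      refine ((Set.finite_Iic n).biUnion fun i _ => Set.toFinite {(p i).1, (p i).2}).subset ?_
      rintro k ⟨⟨i, hi⟩, hk⟩
      refine Set.mem_biUnion (x := i) ?_ hi
      have := hle i
      simp only [Set.mem_Iic]
      rcases hi with rfl | rfl <;> omega)
    obtain ⟨M, hM⟩ := (hE.image ρ).bddAbove
    have hout : ∀ k, M < ρ k → k ∉ E := fun k hk hkE =>
      absurd (hM ⟨k, hkE, rfl⟩) (not_le.2 hk)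
    have hM1 := hle (M + 1)
    exact (hpP (M + 1)).1 (hEinj ⟨⟨_, Or.inl rfl⟩, hout _ (by omega)⟩
      ⟨⟨_, Or.inr rfl⟩, hout _ (by omega)⟩ (hpP (M + 1)).2)
  have hG : IsAlmostHom fun V => {k | n₀ < ρ k ∧ h k ∈ F V} := by
    refine ⟨fun x y => ?_, fun x y hxy => ?_⟩
    · filter_upwards [eventually_cofinite_comp_of_injOn hinj (hF.isAlmostHom.union x y)] with k hk
      exact ⟨fun ⟨h1, h2⟩ => ((hk h1).1 h2).imp (⟨h1, ·⟩) (⟨h1, ·⟩),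
        Or.rec (fun h1 => ⟨h1.1, (hk h1.1).2 (Or.inl h1.2)⟩)
          fun h1 => ⟨h1.1, (hk h1.1).2 (Or.inr h1.2)⟩⟩
    · filter_upwards [eventually_cofinite_comp_of_injOn hinj (hF.isAlmostHom.disjoint x y hxy)]
        with k hk hk'
      exact hk hk'.1.1 ⟨hk'.1.2, hk'.2.2⟩
  obtain ⟨n, hn⟩ := hG.exists_uniform_level (ρ := ρ) (by
    intro V
    by_contra! hcon
    obtain ⟨f, hfP, hfr⟩ := exists_seq_of_forall_finset_exists
      (fun k => n₀ < ρ k ∧ ¬(k ∈ V ↔ h k ∈ F V)) (fun k l => ρ k < ρ l) (by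
        intro s _
        obtain ⟨k, hk⟩ := (hcon (max n₀ (s.sup ρ))).exists
        have hk0 : n₀ < ρ k := (le_max_left _ _).trans_lt (by tauto)
        have hks : s.sup ρ < ρ k := (le_max_right _ _).trans_lt (by tauto)
        refine ⟨k, ⟨hk0, ?_⟩, fun l hl => (Finset.le_sup hl).trans_lt hks⟩
        have hkG : k ∈ {k | n₀ < ρ k ∧ h k ∈ F V} ↔ h k ∈ F V := and_iff_right hk0
        tauto)
    have hmono : StrictMono (ρ ∘ f) := fun i j hij => hfr i j hij
    have himg := (hh (Set.range f) (by
      intro n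
      refine ((Set.finite_Iic n).image f).subset ?_
      rintro _ ⟨⟨i, rfl⟩, hi⟩
      exact ⟨i, (hmono.id_le i).trans hi, rfl⟩)).1
    have h1 := eventually_cofinite_comp_of_injOn hinj
      (eqStar_iff.1 (himg (Set.range f ∩ V) Set.inter_subset_left))
    have h2 := eventually_cofinite_comp_of_injOn hinj
      (eqStar_iff.1 (himg (Set.range f \ V) Set.sdiff_subset))
    have h3 := eventually_cofinite_comp_of_injOn hinj
      (hF.isAlmostHom.mono (x := Set.range f ∩ V) (y := V) Set.inter_subset_right)
    have h4 := eventually_cofinite_comp_of_injOn hinj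
      (hF.isAlmostHom.disjoint (Set.range f \ V) V Set.disjoint_sdiff_left)
    refine Set.infinite_range_of_injective (f := f)
      (Function.Injective.of_comp hmono.injective) ?_
    have : ∀ᶠ k in cofinite, k ∉ Set.range f := by
      filter_upwards [h1, h2, h3, h4] with k h1 h2 h3 h4 hk
      obtain ⟨i, rfl⟩ := hk
      obtain ⟨hS, hne⟩ := hfP i
      by_cases hV : f i ∈ V
      · exact hne (iff_of_true hV (h3 hS ((h1 hS).2 ⟨f i, ⟨⟨i, rfl⟩, hV⟩, rfl⟩)))
      · exact hne (iff_of_false hV fun h5 =>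
          h4 hS ⟨(h2 hS).2 ⟨f i, ⟨⟨i, rfl⟩, hV⟩, rfl⟩, h5⟩)
    exact finite_of_eventually_notMem this)
  have hinj' : Set.InjOn h {k | max n n₀ < ρ k} :=
    hinj.mono fun k (hk : max n n₀ < ρ k) => (le_max_right _ _).trans_lt hk
  refine ⟨max n n₀, h, hinj', fun x hx => hF.eqStar_image_of_almost_subset hinj' ?_ hx⟩
  intro x hx
  filter_upwards [hn x] with k hk hkx
  exact (hk ((le_max_left _ _).trans_lt (hx hkx)) hkx).2

end InducesAuto

theorem notP (hω : OmegaCohere) (F : Set ℕ → Set ℕ) (hF : InducesAuto F)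
    (hproper : Set.univ ∉ Triv F)
    (hdense : ∀ B : Set ℕ, B.Infinite → ∃ b ⊆ B, b.Infinite ∧ b ∈ Triv F)
    (a : ℕ → Set ℕ) (hinc : ∀ n m : ℕ, n ≤ m → (a n \ a m).Finite) :
    (∃ n : ℕ, (a n)ᶜ ∈ Triv F) ∨
    ∃ b : Set ℕ, b.Infinite ∧ b ∉ Triv F ∧ ∀ n : ℕ, (b ∩ a n).Finite := by
  classical
  by_contra! hcon
  obtain ⟨hnot, horth⟩ := hcon
  have htriv : ∀ b : Set ℕ, (∀ n, (b ∩ a n).Finite) → b ∈ Triv F := by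
    intro b hb
    by_contra hbt
    obtain ⟨n, hn⟩ := horth b (fun hfin => hbt (hF.mem_triv_of_finite hfin)) hbt
    exact hn (hb n)
  obtain ⟨n₁, hn₁⟩ : ∃ n, (a n).Infinite := by
    by_contra! hfin
    exact hproper (htriv _ fun n => (hfin n).subset Set.inter_subset_right)
  have hex : ∀ k, ∃ n, k ∈ a n ∨ k ≤ n := fun k => ⟨k, Or.inr le_rfl⟩
  obtain ⟨n, hn⟩ := hF.exists_level_mem_triv hω (ρ := fun k => Nat.find (hex k)) (by
    refine fun b hb => htriv b fun n => (hb n).subset ?_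
    rintro k ⟨hkb, hk⟩
    exact ⟨hkb, Nat.find_min' (hex k) (Or.inl hk)⟩)
  refine hnot (max n n₁) (hF.mem_triv_of_almost_subset hn ?_ ?_)
  · refine ((Set.finite_Iic n).union ((Set.finite_Iic n).biUnion fun i hi =>
      hinc i (max n n₁) (le_trans hi (le_max_left _ _)))).subset ?_
    rintro k ⟨hk, hk'⟩
    have hle : Nat.find (hex k) ≤ n := not_lt.1 hk'
    rcases Nat.find_spec (hex k) with h | h
    · exact Or.inr (Set.mem_biUnion (x := Nat.find (hex k)) hle ⟨h, hk⟩)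
    · exact Or.inl (h.trans hle)
  · rw [compl_compl]
    intro hfin
    refine hn₁ ((hfin.union (hinc n₁ (max n n₁) (le_max_right _ _))).subset fun k hk => ?_)
    by_cases h : k ∈ a (max n n₁)
    · exact Or.inl h
    · exact Or.inr ⟨hk, h⟩
end

section
/- Let H = ⟨h_α : α < ω₁⟩ be a coherent family of partial functions from ℕ to ℕ indexed by the countable ordinals such that the domains are ⊆*-increasing (dom h_α ⊆* dom h_β whenever α ≤ β < ω₁), and such that there is no total function h : ℕ → ℕ with {n ∈ dom h_α : h_α n ≠ h n} finite for every α < ω₁. Then the poset Q(H) is ccc: every set of pairwise incompatible conditions of Q(H) is countable. -/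
/-- Conditions of the poset `Q(H)` for a family `H` of partial functions from ℕ
to ℕ indexed by ordinals (only indices below `ω₁` are used): a condition
consists of `n`, a family `s` of finite subsets of ℕ indexed by binary
sequences of length `≤ n` (encoded as `List Bool`, via `ρ.take j` for
restrictions), and a finite set `Γ` of countable ordinals. -/
structure QCond (H : Ordinal → Set ℕ × (ℕ → ℕ)) where
  n : ℕ
  s : List Bool → Finset ℕ
  Γ : Finset Ordinal
  gamma_lt : ∀ α ∈ Γ, α < (Cardinal.aleph 1).ord
  sep : ∀ α ∈ Γ, ∀ β ∈ Γ, α ≠ β → ∀ ρ : List Bool, ρ.length = n →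
    ∃ k ∈ s ρ, k ∈ (H α).1 ∧ k ∈ (H β).1 ∧ (H α).2 k ≠ (H β).2 k
  mono : ∀ ρ : List Bool, ρ.length = n → ∀ j k : ℕ, j ≤ k → k ≤ n →
    s (ρ.take j) ⊆ s (ρ.take k)
  inter : ∀ ρ ψ : List Bool, ρ.length = n → ψ.length = n →
    ∀ j : ℕ, j ≤ n → ρ.take j = ψ.take j →
      (j = n ∨ ρ.take (j + 1) ≠ ψ.take (j + 1)) →
      s ρ ∩ s ψ = s (ρ.take j)

/-- The order on `Q(H)`: `q ≤ r` iff `n_q ≥ n_r`, `Γ_q ⊇ Γ_r`, and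
`s^q_ρ = s^r_ρ` for all `ρ ∈ 2^{≤ n_r}`. -/
def QLe {H : Ordinal → Set ℕ × (ℕ → ℕ)} (q r : QCond H) : Prop :=
  r.n ≤ q.n ∧ r.Γ ⊆ q.Γ ∧ ∀ ρ : List Bool, ρ.length ≤ r.n → q.s ρ = r.s ρ

theorem exists_uncountable_fiber {ι C : Type*} [Countable C] {A : Set ι} (hA : ¬ A.Countable)
    (g : ι → C) : ∃ c, ¬ {x ∈ A | g x = c}.Countable := by
  by_contra! h
  refine hA ((Set.countable_iUnion h).mono fun x hx => ?_)
  exact Set.mem_iUnion.2 ⟨g x, hx, rfl⟩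

theorem countable_fiber_of_subset {ι O : Type*} {s t : Set ι} (hst : s ⊆ t) {f : ι → O} {a : O}
    (h : {x ∈ t | f x = a}.Countable) : {x ∈ s | f x = a}.Countable :=
  h.mono fun _ => And.imp_left fun hx => hst hx

/-- Finitely many functions on an uncountable set are simultaneously constant or countable-to-one
on some uncountable subset. -/
theorem exists_uncountable_forall_const_or_countable_fibers {ι O : Type*} {A : Set ι}
    (hA : ¬ A.Countable) (f : ℕ → ι → O) (m : ℕ) :
    ∃ B ⊆ A, ¬ B.Countable ∧ ∀ i < m,
      (∃ a, ∀ x ∈ B, f i x = a) ∨ ∀ a, {x ∈ B | f i x = a}.Countable := by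
  induction m with
  | zero => exact ⟨A, subset_rfl, hA, by simp⟩
  | succ m ih =>
    obtain ⟨B, hBA, hB, h⟩ := ih
    by_cases hm : ∀ a, {x ∈ B | f m x = a}.Countable
    · refine ⟨B, hBA, hB, fun i hi => ?_⟩
      rcases Nat.lt_succ_iff_lt_or_eq.1 hi with hi | rfl
      · exact h i hi
      · exact Or.inr hm
    · push Not at hm
      obtain ⟨a, ha⟩ := hm
      have hsub : {x ∈ B | f m x = a} ⊆ B := fun x hx => hx.1
      refine ⟨_, hsub.trans hBA, ha, fun i hi => ?_⟩
      rcases Nat.lt_succ_iff_lt_or_eq.1 hi with hi | rfl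
      · rcases h i hi with ⟨b, hb⟩ | hc
        · exact Or.inl ⟨b, fun x hx => hb x hx.1⟩
        · exact Or.inr fun b => countable_fiber_of_subset hsub (hc b)
      · exact Or.inl ⟨a, fun x hx => hx.2⟩

theorem countable_Iio_of_lt_ord_aleph_one {γ : Ordinal} (hγ : γ < (Cardinal.aleph 1).ord) :
    (Set.Iio γ).Countable := by
  rw [← Cardinal.le_aleph0_iff_set_countable, Cardinal.mk_Iio_ordinal, Cardinal.lift_le_aleph0,
    ← Order.lt_succ_iff, Cardinal.succ_aleph0]
  exact Cardinal.lt_ord.1 hγ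

theorem exists_ge_of_countable_fibers {ι : Type*} {X : Set ι} (hX : ¬ X.Countable)
    {f : ι → Ordinal} (hf : ∀ a, {x ∈ X | f x = a}.Countable) {γ : Ordinal}
    (hγ : γ < (Cardinal.aleph 1).ord) : ∃ x ∈ X, γ ≤ f x := by
  by_contra! h
  refine hX (((countable_Iio_of_lt_ord_aleph_one hγ).biUnion fun a _ => hf a).mono fun x hx => ?_)
  exact Set.mem_biUnion (h x hx) ⟨hx, rfl⟩

/-- Two partial functions take different values at a common point `k` of their domains. -/
def DisagreeAt (F G : Set ℕ × (ℕ → ℕ)) (k : ℕ) : Prop :=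
  k ∈ F.1 ∧ k ∈ G.1 ∧ F.2 k ≠ G.2 k

/-- From an uncountable set of partial functions, discard the countably many exceptional ones so
that every value attained is attained uncountably often. -/
theorem exists_uncountable_forall_value {ι : Type*} {X : Set ι} (hX : ¬ X.Countable)
    (F : ι → Set ℕ × (ℕ → ℕ)) :
    ∃ Y ⊆ X, ¬ Y.Countable ∧ ∀ y ∈ Y, ∀ k ∈ (F y).1,
      ¬ {x ∈ X | k ∈ (F x).1 ∧ (F x).2 k = (F y).2 k}.Countable := by
  let S : ℕ × ℕ → Set ι := fun c => {x ∈ X | c.1 ∈ (F x).1 ∧ (F x).2 c.1 = c.2}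
  have hU : (⋃ c ∈ {c | (S c).Countable}, S c).Countable :=
    (Set.to_countable _).biUnion fun c hc => hc
  refine ⟨X \ ⋃ c ∈ {c | (S c).Countable}, S c, Set.sdiff_subset, fun h => hX ?_, ?_⟩
  · exact (h.union hU).mono (by rw [Set.sdiff_union_self]; exact Set.subset_union_left)
  · intro y hy k hk hc
    exact hy.2 (Set.mem_biUnion (x := (k, (F y).2 k)) hc ⟨hy.1, hk, rfl⟩)

section

variable {H : Ordinal → Set ℕ × (ℕ → ℕ)}

theorem exists_uncountable_disagreeAt
    (hcoh : ∀ α β : Ordinal, α < (Cardinal.aleph 1).ord → β < (Cardinal.aleph 1).ord →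
      {k ∈ (H α).1 ∩ (H β).1 | (H α).2 k ≠ (H β).2 k}.Finite)
    (hmono : ∀ α β : Ordinal, α ≤ β → β < (Cardinal.aleph 1).ord →
      ((H α).1 \ (H β).1).Finite)
    (hnoext : ¬ ∃ h : ℕ → ℕ, ∀ α : Ordinal, α < (Cardinal.aleph 1).ord →
      {k ∈ (H α).1 | (H α).2 k ≠ h k}.Finite)
    {ι : Type*} {X Y : Set ι} (hX : ¬ X.Countable) (hY : ¬ Y.Countable) {f g : ι → Ordinal}
    (hf : ∀ x ∈ X, f x < (Cardinal.aleph 1).ord) (hg : ∀ y ∈ Y, g y < (Cardinal.aleph 1).ord)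
    (hfX : ∀ a, {x ∈ X | f x = a}.Countable) (hgY : ∀ a, {y ∈ Y | g y = a}.Countable) (K : ℕ) :
    ∃ k > K, ∃ X' ⊆ X, ∃ Y' ⊆ Y, ¬ X'.Countable ∧ ¬ Y'.Countable ∧
      ∀ x ∈ X', ∀ y ∈ Y', DisagreeAt (H (f x)) (H (g y)) k := by
  classical
  obtain ⟨X₀, hX₀X, hX₀, hXv⟩ := exists_uncountable_forall_value hX fun x => H (f x)
  obtain ⟨Y₀, hY₀Y, hY₀, hYv⟩ := exists_uncountable_forall_value hY fun y => H (g y)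
  by_contra hcon
  have agree : ∀ x ∈ X₀, ∀ y ∈ Y₀, ∀ k > K, k ∈ (H (f x)).1 → k ∈ (H (g y)).1 →
      (H (f x)).2 k = (H (g y)).2 k := by
    intro x hx y hy k hk hkx hky
    by_contra hne
    refine hcon ⟨k, hk, _, Set.sep_subset _ _, _, Set.sep_subset _ _, hXv x hx k hkx,
      hYv y hy k hky, ?_⟩
    rintro x' ⟨-, hx', hxe⟩ y' ⟨-, hy', hye⟩
    exact ⟨hx', hy', by rw [hxe, hye]; exact hne⟩
  refine hnoext ⟨fun k => if h : ∃ y ∈ Y₀, k ∈ (H (g y)).1 then (H (g h.choose)).2 k else 0,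
    fun γ hγ => ?_⟩
  obtain ⟨x, hx, hγx⟩ := exists_ge_of_countable_fibers hX₀
    (fun a => countable_fiber_of_subset hX₀X (hfX a)) hγ
  have hfx := hf x (hX₀X hx)
  obtain ⟨y, hy, hxy⟩ := exists_ge_of_countable_fibers hY₀
    (fun a => countable_fiber_of_subset hY₀Y (hgY a)) hfx
  refine ((((hmono γ _ hγx hfx).union (hcoh γ _ hγ hfx)).union
    (hmono _ _ hxy (hg y (hY₀Y hy)))).union (Set.finite_Iic K)).subset ?_
  rintro k ⟨hkγ, hk⟩
  by_contra hnot
  simp only [Set.mem_union, Set.mem_sdiff, Set.mem_ofPred_eq, Set.mem_inter_iff, Set.mem_Iic,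
    not_or, not_and, not_not, not_le] at hnot
  obtain ⟨⟨⟨h1, h2⟩, h3⟩, h4⟩ := hnot
  have hkx := h1 hkγ
  have hex : ∃ y ∈ Y₀, k ∈ (H (g y)).1 := ⟨y, hy, h3 hkx⟩
  apply hk
  simp only [dif_pos hex]
  rw [h2 ⟨hkγ, hkx⟩]
  exact agree x hx _ hex.choose_spec.1 k h4 hkx hex.choose_spec.2

theorem exists_uncountable_forall_disagreeAt
    (hcoh : ∀ α β : Ordinal, α < (Cardinal.aleph 1).ord → β < (Cardinal.aleph 1).ord →
      {k ∈ (H α).1 ∩ (H β).1 | (H α).2 k ≠ (H β).2 k}.Finite)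
    (hmono : ∀ α β : Ordinal, α ≤ β → β < (Cardinal.aleph 1).ord →
      ((H α).1 \ (H β).1).Finite)
    (hnoext : ¬ ∃ h : ℕ → ℕ, ∀ α : Ordinal, α < (Cardinal.aleph 1).ord →
      {k ∈ (H α).1 | (H α).2 k ≠ h k}.Finite)
    {ι τ : Type*} {B : Set ι} (hB : ¬ B.Countable) (f g : τ → ι → Ordinal) (T : Finset τ)
    (hf : ∀ t ∈ T, ∀ x ∈ B, f t x < (Cardinal.aleph 1).ord)
    (hg : ∀ t ∈ T, ∀ x ∈ B, g t x < (Cardinal.aleph 1).ord)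
    (hfB : ∀ t ∈ T, ∀ a, {x ∈ B | f t x = a}.Countable)
    (hgB : ∀ t ∈ T, ∀ a, {x ∈ B | g t x = a}.Countable) (K : ℕ) :
    ∃ X ⊆ B, ∃ Y ⊆ B, ¬ X.Countable ∧ ¬ Y.Countable ∧ ∃ k : τ → ℕ,
      Set.InjOn k T ∧ ∀ t ∈ T, K < k t ∧
        ∀ x ∈ X, ∀ y ∈ Y, DisagreeAt (H (f t x)) (H (g t y)) (k t) := by
  classical
  induction T using Finset.induction_on with
  | empty => exact ⟨B, subset_rfl, B, subset_rfl, hB, hB, fun _ => 0, by simp, by simp⟩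
  | insert t T ht ih =>
    obtain ⟨X, hXB, Y, hYB, hX, hY, k, hk, hkT⟩ := ih
      (fun t h => hf t (Finset.mem_insert_of_mem h)) (fun t h => hg t (Finset.mem_insert_of_mem h))
      (fun t h => hfB t (Finset.mem_insert_of_mem h))
      (fun t h => hgB t (Finset.mem_insert_of_mem h))
    have htT := Finset.mem_insert_self t T
    obtain ⟨k₀, hk₀, X', hX'X, Y', hY'Y, hX', hY', hdis⟩ :=
      exists_uncountable_disagreeAt hcoh hmono hnoext hX hY
        (fun x hx => hf t htT x (hXB hx)) (fun y hy => hg t htT y (hYB hy))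
        (fun a => countable_fiber_of_subset hXB (hfB t htT a))
        (fun a => countable_fiber_of_subset hYB (hgB t htT a)) (max K (T.sup k))
    have hlt : ∀ t' ∈ T, k t' < k₀ := fun t' h =>
      ((Finset.le_sup h).trans (le_max_right _ _)).trans_lt hk₀
    have hne : ∀ t' ∈ T, t' ≠ t := fun t' h e => ht (e ▸ h)
    refine ⟨X', hX'X.trans hXB, Y', hY'Y.trans hYB, hX', hY', Function.update k t k₀, ?_, ?_⟩
    · intro a ha b hb hab
      rcases Finset.mem_insert.1 (Finset.mem_coe.1 ha) with hat | ha <;>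
        rcases Finset.mem_insert.1 (Finset.mem_coe.1 hb) with hbt | hb
      · exact hat.trans hbt.symm
      · rw [hat, Function.update_self, Function.update_of_ne (hne b hb)] at hab
        exact absurd hab (hlt b hb).ne'
      · rw [hbt, Function.update_self, Function.update_of_ne (hne a ha)] at hab
        exact absurd hab (hlt a ha).ne
      · rw [Function.update_of_ne (hne a ha), Function.update_of_ne (hne b hb)] at hab
        exact hk ha hb hab
    · intro a ha
      rcases Finset.mem_insert.1 ha with rfl | ha
      · rw [Function.update_self]
        exact ⟨(le_max_left _ _).trans_lt hk₀, hdis⟩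
      · rw [Function.update_of_ne (hne a ha)]
        exact ⟨(hkT a ha).1, fun x hx y hy => (hkT a ha).2 x (hX'X hx) y (hY'Y hy)⟩

/-- Two conditions with the same finite sets have a common extension as soon as there are pairwise
disjoint sets of new points, one for each sequence of length `n + 1`, each of which separates the
two sets of ordinals. -/
theorem QCond.exists_common_extension (p q : QCond H) (hn : q.n = p.n)
    (hs : ∀ ρ : List Bool, ρ.length ≤ p.n → q.s ρ = p.s ρ) (F : List Bool → Finset ℕ)
    (hFs : ∀ ρ σ : List Bool, ρ.length = p.n + 1 → σ.length = p.n → Disjoint (F ρ) (p.s σ))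
    (hF : ∀ ρ σ : List Bool, ρ.length = p.n + 1 → σ.length = p.n + 1 → ρ ≠ σ →
      Disjoint (F ρ) (F σ))
    (hsep : ∀ ρ : List Bool, ρ.length = p.n + 1 → ∀ α ∈ p.Γ, ∀ β ∈ q.Γ, α ∉ q.Γ → β ∉ p.Γ →
      ∃ k ∈ F ρ, DisagreeAt (H α) (H β) k) :
    ∃ r : QCond H, QLe r p ∧ QLe r q := by
  classical
  let s : List Bool → Finset ℕ := fun ρ =>
    if ρ.length ≤ p.n then p.s ρ else p.s (ρ.take p.n) ∪ F ρ
  have s_le : ∀ ρ : List Bool, ρ.length ≤ p.n → s ρ = p.s ρ := fun ρ h => if_pos h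
  have s_top : ∀ ρ : List Bool, ρ.length = p.n + 1 → s ρ = p.s (ρ.take p.n) ∪ F ρ :=
    fun ρ h => if_neg (by omega)
  have len_take : ∀ ρ : List Bool, ρ.length = p.n + 1 → (ρ.take p.n).length = p.n :=
    fun ρ h => by simp [h]
  have take_le : ∀ (ρ : List Bool) (j : ℕ), j ≤ p.n →
      s (ρ.take j) = p.s ((ρ.take p.n).take j) := fun ρ j hj => by
    rw [s_le _ (by simp [hj]), List.take_take, min_eq_left hj]
  have sep_mixed : ∀ ρ : List Bool, ρ.length = p.n + 1 → ∀ α ∈ p.Γ, ∀ β ∈ q.Γ, α ≠ β →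
      ∃ k ∈ s ρ, DisagreeAt (H α) (H β) k := by
    intro ρ hρ α hα β hβ hne
    rw [s_top ρ hρ]
    by_cases hβp : β ∈ p.Γ
    · obtain ⟨k, hk, h⟩ := p.sep α hα β hβp hne _ (len_take ρ hρ)
      exact ⟨k, Finset.mem_union_left _ hk, h⟩
    by_cases hαq : α ∈ q.Γ
    · obtain ⟨k, hk, h⟩ := q.sep α hαq β hβ hne _ ((len_take ρ hρ).trans hn.symm)
      rw [hs _ (len_take ρ hρ).le] at hk
      exact ⟨k, Finset.mem_union_left _ hk, h⟩
    obtain ⟨k, hk, h⟩ := hsep ρ hρ α hα β hβ hαq hβp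
    exact ⟨k, Finset.mem_union_right _ hk, h⟩
  refine ⟨⟨p.n + 1, s, p.Γ ∪ q.Γ, ?_, ?_, ?_, ?_⟩, ?_, ?_⟩
  · intro α hα
    exact (Finset.mem_union.1 hα).elim (p.gamma_lt α) (q.gamma_lt α)
  · intro α hα β hβ hne ρ hρ
    rcases Finset.mem_union.1 hα with hα | hα <;> rcases Finset.mem_union.1 hβ with hβ | hβ
    · obtain ⟨k, hk, h⟩ := p.sep α hα β hβ hne _ (len_take ρ hρ)
      exact ⟨k, by rw [s_top ρ hρ]; exact Finset.mem_union_left _ hk, h⟩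
    · exact sep_mixed ρ hρ α hα β hβ hne
    · obtain ⟨k, hk, h1, h2, h3⟩ := sep_mixed ρ hρ β hβ α hα hne.symm
      exact ⟨k, hk, h2, h1, h3.symm⟩
    · obtain ⟨k, hk, h⟩ := q.sep α hα β hβ hne _ ((len_take ρ hρ).trans hn.symm)
      rw [hs _ (len_take ρ hρ).le] at hk
      exact ⟨k, by rw [s_top ρ hρ]; exact Finset.mem_union_left _ hk, h⟩
  · intro ρ hρ j k hjk hk
    rcases Nat.le_succ_iff.1 hk with hk | rfl
    · rw [take_le ρ j (hjk.trans hk), take_le ρ k hk]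
      exact p.mono _ (len_take ρ hρ) j k hjk hk
    · rcases Nat.le_succ_iff.1 hjk with hj | rfl
      · rw [take_le ρ j hj, List.take_of_length_le hρ.le, s_top ρ hρ]
        have h := p.mono _ (len_take ρ hρ) j p.n hj le_rfl
        rw [List.take_of_length_le (len_take ρ hρ).le] at h
        exact h.trans Finset.subset_union_left
      · exact subset_rfl
  · intro ρ ψ hρ hψ j hj hjeq hjne
    rcases Nat.le_succ_iff.1 hj with hj | rfl
    · have hjne' : ρ.take (j + 1) ≠ ψ.take (j + 1) := hjne.resolve_left (by omega)
      have hne : ρ ≠ ψ := fun h => hjne' (h ▸ rfl)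
      rw [take_le ρ j hj, s_top ρ hρ, s_top ψ hψ,
        ← p.inter _ (ψ.take p.n) (len_take ρ hρ) (len_take ψ hψ) j hj
          (by simpa only [List.take_take, min_eq_left hj] using hjeq) ?_]
      · rw [Finset.union_inter_distrib_right, Finset.inter_union_distrib_left,
          Finset.inter_union_distrib_left,
          Finset.disjoint_iff_inter_eq_empty.1 (hF ρ ψ hρ hψ hne),
          Finset.disjoint_iff_inter_eq_empty.1 (hFs ρ _ hρ (len_take ψ hψ)),
          Finset.disjoint_iff_inter_eq_empty.1 (hFs ψ _ hψ (len_take ρ hρ)).symm]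
        simp
      · rcases hj.eq_or_lt with h | h
        · exact Or.inl h
        · right
          rwa [List.take_take, List.take_take, min_eq_left (by omega)]
    · rw [List.take_of_length_le hρ.le, List.take_of_length_le hψ.le] at hjeq
      rw [hjeq, Finset.inter_self, List.take_of_length_le hψ.le]
  · exact ⟨Nat.le_succ _, Finset.subset_union_left, s_le⟩
  · refine ⟨hn.le.trans (Nat.le_succ _), Finset.subset_union_right, fun ρ hρ => ?_⟩
    rw [hn] at hρ
    exact (s_le ρ hρ).trans (hs ρ hρ).symm

end

/-- If `H = ⟨h_α : α < ω₁⟩` is a coherent family of partial functions with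
`⊆*`-increasing domains that cannot be coherently extended by a total function,
then `Q(H)` is ccc. -/
theorem QH_ccc (H : Ordinal → Set ℕ × (ℕ → ℕ))
    (hcoh : ∀ α β : Ordinal, α < (Cardinal.aleph 1).ord → β < (Cardinal.aleph 1).ord →
      {k ∈ (H α).1 ∩ (H β).1 | (H α).2 k ≠ (H β).2 k}.Finite)
    (hmono : ∀ α β : Ordinal, α ≤ β → β < (Cardinal.aleph 1).ord →
      ((H α).1 \ (H β).1).Finite)
    (hnoext : ¬ ∃ h : ℕ → ℕ, ∀ α : Ordinal, α < (Cardinal.aleph 1).ord →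
      {k ∈ (H α).1 | (H α).2 k ≠ h k}.Finite) :
    ∀ A : Set (QCond H),
      (∀ p ∈ A, ∀ q ∈ A, p ≠ q → ¬ ∃ r : QCond H, QLe r p ∧ QLe r q) →
      A.Countable := by
  classical
  intro A hA
  by_contra hunc
  let L : ℕ → Finset (List Bool) := fun n => (List.finite_length_le Bool n).toFinset
  have memL : ∀ n ρ, ρ ∈ L n ↔ ρ.length ≤ n := fun n ρ => by simp [L]
  obtain ⟨⟨n, m, S⟩, hA₁⟩ := exists_uncountable_fiber hunc fun p : QCond H =>
    (p.n, p.Γ.toList.length, (L p.n).image fun ρ => (ρ, p.s ρ))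
  let f : ℕ → QCond H → Ordinal := fun i p => p.Γ.toList.getD i 0
  obtain ⟨B, hBA, hB, hfB⟩ := exists_uncountable_forall_const_or_countable_fibers hA₁ f m
  have hBn : ∀ p ∈ B, p.n = n := fun p hp => (Prod.ext_iff.1 (hBA hp).2).1
  have hBm : ∀ p ∈ B, p.Γ.toList.length = m := fun p hp =>
    (Prod.ext_iff.1 (Prod.ext_iff.1 (hBA hp).2).2).1
  have hBS : ∀ p ∈ B, ((L n).image fun ρ => (ρ, p.s ρ)) = S := fun p hp => by
    rw [← hBn p hp]
    exact (Prod.ext_iff.1 (Prod.ext_iff.1 (hBA hp).2).2).2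
  have hBs : ∀ p ∈ B, ∀ q ∈ B, ∀ ρ : List Bool, ρ.length ≤ n → p.s ρ = q.s ρ := by
    intro p hp q hq ρ hρ
    have h : (ρ, p.s ρ) ∈ (L n).image fun ρ => (ρ, q.s ρ) := by
      rw [hBS q hq, ← hBS p hp]
      exact Finset.mem_image_of_mem (fun ρ => (ρ, p.s ρ)) ((memL n ρ).2 hρ)
    obtain ⟨σ, -, hσ⟩ := Finset.mem_image.1 h
    obtain ⟨rfl, h'⟩ := Prod.ext_iff.1 hσ
    exact h'.symm
  have hfmem : ∀ p ∈ B, ∀ i < m, f i p ∈ p.Γ := by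
    intro p hp i hi
    have hi' : i < p.Γ.toList.length := (hBm p hp).symm ▸ hi
    rw [← Finset.mem_toList]
    simp only [f]
    rw [List.getD_eq_getElem _ _ hi']
    exact List.getElem_mem hi'
  have hfsurj : ∀ p ∈ B, ∀ α ∈ p.Γ, ∃ i < m, f i p = α := by
    intro p hp α hα
    obtain ⟨i, hi, h⟩ := List.getElem_of_mem (Finset.mem_toList.2 hα)
    exact ⟨i, hBm p hp ▸ hi, (List.getD_eq_getElem _ _ hi).trans h⟩
  obtain ⟨p₀, hp₀⟩ : B.Nonempty := Set.nonempty_iff_ne_empty.2 fun h => hB (h ▸ Set.countable_empty)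
  let T : Finset (List Bool × ℕ × ℕ) :=
    (L (n + 1) ×ˢ Finset.range m ×ˢ Finset.range m).filter fun t =>
      (∀ a, {x ∈ B | f t.2.1 x = a}.Countable) ∧ ∀ a, {x ∈ B | f t.2.2 x = a}.Countable
  have hT : ∀ t ∈ T, t.2.1 < m ∧ t.2.2 < m ∧
      (∀ a, {x ∈ B | f t.2.1 x = a}.Countable) ∧ ∀ a, {x ∈ B | f t.2.2 x = a}.Countable := by
    intro t ht
    simp only [T, Finset.mem_filter, Finset.mem_product, Finset.mem_range] at ht
    exact ⟨ht.1.2.1, ht.1.2.2, ht.2⟩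
  obtain ⟨X, hXB, Y, hYB, hX, hY, k, hk, hkT⟩ :=
    exists_uncountable_forall_disagreeAt hcoh hmono hnoext hB
      (fun t : List Bool × ℕ × ℕ => f t.2.1) (fun t => f t.2.2) T
      (fun t ht x hx => x.gamma_lt _ (hfmem x hx _ (hT t ht).1))
      (fun t ht x hx => x.gamma_lt _ (hfmem x hx _ (hT t ht).2.1))
      (fun t ht => (hT t ht).2.2.1) (fun t ht => (hT t ht).2.2.2)
      (((L n).biUnion p₀.s).sup id)
  obtain ⟨p, hp⟩ : X.Nonempty := Set.nonempty_iff_ne_empty.2 fun h => hX (h ▸ Set.countable_empty)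
  obtain ⟨q, hq, hqp⟩ : ∃ q ∈ Y, q ≠ p := by
    by_contra! h
    exact hY ((Set.countable_singleton p).mono h)
  have hpB := hXB hp
  have hqB := hYB hq
  have hpn := hBn p hpB
  refine hA p (hBA hpB).1 q (hBA hqB).1 hqp.symm (p.exists_common_extension q
    ((hBn q hqB).trans hpn.symm) (fun ρ hρ => hBs q hqB p hpB ρ (hpn ▸ hρ))
    (fun ρ => (T.filter fun t => t.1 = ρ).image k) ?_ ?_ ?_)
  · intro ρ σ _ hσ
    rw [Finset.disjoint_left]
    intro a ha haσ
    obtain ⟨t, ht, rfl⟩ := Finset.mem_image.1 ha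
    rw [hBs p hpB p₀ hp₀ σ (by omega)] at haσ
    refine (hkT t (Finset.mem_filter.1 ht).1).1.not_ge (Finset.le_sup (f := id) ?_)
    exact Finset.mem_biUnion.2 ⟨σ, (memL n σ).2 (by omega), haσ⟩
  · intro ρ σ _ _ hne
    rw [Finset.disjoint_left]
    intro a ha haσ
    obtain ⟨t, ht, rfl⟩ := Finset.mem_image.1 ha
    obtain ⟨u, hu, hut⟩ := Finset.mem_image.1 haσ
    rw [Finset.mem_filter] at ht hu
    exact hne (ht.2.symm.trans (hk hu.1 ht.1 hut ▸ hu.2))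
  · intro ρ hρ α hα β hβ hαq hβp
    obtain ⟨i, hi, rfl⟩ := hfsurj p hpB α hα
    obtain ⟨j, hj, rfl⟩ := hfsurj q hqB β hβ
    have hi' := (hfB i hi).resolve_left fun ⟨a, ha⟩ =>
      hαq (by rw [ha p hpB, ← ha q hqB]; exact hfmem q hqB i hi)
    have hj' := (hfB j hj).resolve_left fun ⟨a, ha⟩ =>
      hβp (by rw [ha q hqB, ← ha p hpB]; exact hfmem p hpB j hj)
    have ht : (ρ, i, j) ∈ T := by
      simp only [T, Finset.mem_filter, Finset.mem_product, Finset.mem_range, memL]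
      exact ⟨⟨by omega, hi, hj⟩, hi', hj'⟩
    exact ⟨k (ρ, i, j), Finset.mem_image_of_mem k (Finset.mem_filter.2 ⟨ht, rfl⟩),
      (hkT _ ht).2 p hp q hq⟩
end

section
/- Suppose F : Set ℕ → Set ℕ induces an automorphism of P(ω)/fin, a ⊆ ℕ is infinite with a ∉ triv(F), and h : ℕ → ℕ is injective on a. Then there exists an infinite set x ⊆ a such that h '' x ∩ F x is finite. -/
namespace EqStar

theorem diff_finite {x y : Set ℕ} (h : EqStar x y) : (x \ y).Finite :=
  h.subset Set.subset_union_left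

theorem symm {x y : Set ℕ} (h : EqStar x y) : EqStar y x := by
  unfold EqStar at *
  rwa [Set.union_comm]

end EqStar

namespace InducesAuto

variable {F : Set ℕ → Set ℕ}

theorem diff_finite_of_subset (hF : InducesAuto F) {x y : Set ℕ} (hxy : x ⊆ y) :
    (F x \ F y).Finite := by
  have h := (hF.2.1 x y).symm.diff_finite
  rw [Set.union_eq_self_of_subset_left hxy] at h
  exact h.subset (Set.sdiff_subset_sdiff_left Set.subset_union_left)

theorem diff_finite_of_image (hF : InducesAuto F) {x y : Set ℕ} (hxy : (F x \ F y).Finite) :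
    (x \ y).Finite := by
  have h₁ := hF.2.1 x y
  have h₂ : EqStar (F (x ∪ y)) (F y) := by
    refine (h₁.union hxy).subset ?_
    intro n hn
    simp only [Set.mem_union, Set.mem_sdiff] at hn ⊢
    tauto
  refine (hF.2.2.2.1 _ _ h₂).diff_finite.subset ?_
  exact Set.sdiff_subset_sdiff_left Set.subset_union_left

theorem empty_finite (hF : InducesAuto F) : (F ∅).Finite := by
  have h₁ := hF.diff_finite_of_subset (Set.empty_subset Set.univ)
  have h₂ := (hF.2.2.1 Set.univ).diff_finite
  rw [Set.compl_univ] at h₂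
  refine (h₁.union h₂).subset ?_
  intro n hn
  simp only [Set.mem_union, Set.mem_sdiff, Set.mem_compl_iff]
  tauto

theorem map_finite (hF : InducesAuto F) {x : Set ℕ} (hx : x.Finite) : (F x).Finite := by
  have h := hF.1 x ∅ (by simpa [EqStar] using hx)
  refine (h.diff_finite.union hF.empty_finite).subset ?_
  intro n hn
  simp only [Set.mem_union, Set.mem_sdiff]
  tauto

end InducesAuto

theorem badx (F : Set ℕ → Set ℕ) (hF : InducesAuto F)
    (a : Set ℕ) (ha : a.Infinite) (haT : a ∉ Triv F)
    (h : ℕ → ℕ) (hinj : Set.InjOn h a) :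
    ∃ x : Set ℕ, x ⊆ a ∧ x.Infinite ∧ (h '' x ∩ F x).Finite := by
  obtain ⟨x, hxa, hx⟩ : ∃ x : Set ℕ, x ⊆ a ∧ ¬ EqStar (F x) (h '' x) := by
    by_contra! hc
    exact haT ⟨h, hinj, hc⟩
  rw [EqStar, Set.finite_union, not_and_or] at hx
  rcases hx with hx | hx
  · obtain ⟨z, hz⟩ := hF.2.2.2.2 (F x \ h '' x)
    have hzx : (z \ x).Finite := by
      refine hF.diff_finite_of_image (hz.diff_finite.subset ?_)
      exact Set.sdiff_subset_sdiff_right Set.sdiff_subset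
    refine ⟨z ∩ x, Set.inter_subset_right.trans hxa, fun hfin => hx ?_, ?_⟩
    · have hzfin : z.Finite := by
        rw [← Set.inter_union_sdiff z x]
        exact hfin.union hzx
      refine ((hF.map_finite hzfin).union hz.symm.diff_finite).subset ?_
      intro n hn
      simp only [Set.mem_union, Set.mem_sdiff] at hn ⊢
      tauto
    · refine ((hF.diff_finite_of_subset (Set.inter_subset_left : z ∩ x ⊆ z)).union
        hz.diff_finite).subset ?_
      rintro n ⟨hn, hn'⟩
      have hnx : n ∈ h '' x := Set.image_mono Set.inter_subset_right hn
      simp only [Set.mem_union, Set.mem_sdiff]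
      tauto
  · refine ⟨{n ∈ x | h n ∉ F x}, (Set.sep_subset _ _).trans hxa, fun hfin => hx ?_, ?_⟩
    · refine (hfin.image h).subset ?_
      rintro _ ⟨⟨n, hn, rfl⟩, hn'⟩
      exact ⟨n, ⟨hn, hn'⟩, rfl⟩
    · refine (hF.diff_finite_of_subset (Set.sep_subset x fun n => h n ∉ F x)).subset ?_
      rintro _ ⟨⟨n, hn, rfl⟩, hn'⟩
      exact ⟨hn', hn.2⟩
end

section
/- Let ⟨h_α : α < ω₁⟩ be a family of partial functions from ℕ to ℕ indexed by the countable ordinals that is Luzin incoherent: for all α < β < ω₁ there exists n ∈ dom h_α ∩ dom h_β with h_α n ≠ h_β n. Then for every total function h : ℕ → ℕ the family ⟨h_α⟩ together with h is not coherent; that is, there exists α < ω₁ such that the set {n ∈ dom h_α : h_α n ≠ h n} is infinite. -/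
theorem luzin_not_coherent (H : Ordinal → Set ℕ × (ℕ → ℕ))
    (hLuzin : ∀ α β : Ordinal, α < β → β < (Cardinal.aleph 1).ord →
      ∃ n : ℕ, n ∈ (H α).1 ∧ n ∈ (H β).1 ∧ (H α).2 n ≠ (H β).2 n)
    (h : ℕ → ℕ) :
    ∃ α : Ordinal, α < (Cardinal.aleph 1).ord ∧
      {n ∈ (H α).1 | (H α).2 n ≠ h n}.Infinite := by
  by_contra! hfin
  -- The finite disagreement with `h`, as a subset of the graph, determines `α`.
  let code : Set.Iio (Cardinal.aleph 1).ord → Finset (ℕ × ℕ) := fun α =>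
    (hfin α.1 α.2).toFinset.image fun n => (n, (H α.1).2 n)
  have mem_code (α n m) : (n, m) ∈ code α ↔
      (n ∈ (H α.1).1 ∧ (H α.1).2 n ≠ h n) ∧ (H α.1).2 n = m := by
    simp only [code, Finset.mem_image, Set.Finite.mem_toFinset, Set.mem_ofPred_eq, Prod.mk.injEq]
    grind
  have code_ne {α β} (hlt : α < β) : code α ≠ code β := by
    intro heq
    obtain ⟨n, hα, hβ, hne⟩ := hLuzin α.1 β.1 hlt β.2
    have key (m : ℕ) := (mem_code α n m).symm.trans (heq ▸ mem_code β n m)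
    have hkeyα := key ((H α.1).2 n)
    have hkeyβ := key ((H β.1).2 n)
    clear key heq mem_code code
    grind only
  have code_injective : Function.Injective code := fun α β heq => by
    rcases lt_trichotomy α β with hlt | rfl | hlt
    · exact (code_ne hlt heq).elim
    · rfl
    · exact (code_ne hlt heq.symm).elim
  have hcard := Cardinal.mk_le_aleph0_iff.mpr code_injective.countable
  rw [Cardinal.mk_Iio_ordinal, Cardinal.card_ord, Cardinal.lift_le_aleph0] at hcard
  exact hcard.not_gt Cardinal.aleph0_lt_aleph_one
end

section
/- Let ⟨a_α, x_α : α < ω₁⟩ be an ω₁-gap that is a Hausdorff gap, i.e., for every α < ω₁ and every n ∈ ℕ the set {β < α : x_α ∩ (a_β \ x_β) ⊆ [0,n)} is finite. Then no set Y ⊆ ℕ splits the gap: there is no Y ⊆ ℕ with Y ∩ a_α =* x_α for all α < ω₁. -/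
/-- A subset of a linear order all of whose proper initial segments are finite is countable. -/
theorem Set.countable_of_finite_initial_segments {ι : Type*} [LinearOrder ι] {S : Set ι}
    (h : ∀ i ∈ S, {j | j ∈ S ∧ j < i}.Finite) : S.Countable := by
  have hmono : ∀ i ∈ S, ∀ j ∈ S, i < j →
      {k | k ∈ S ∧ k < i}.ncard < {k | k ∈ S ∧ k < j}.ncard := fun i hi j hj hij =>
    Set.ncard_lt_ncard ⟨fun k hk => ⟨hk.1, hk.2.trans hij⟩,
      fun hsub => lt_irrefl i (hsub ⟨hi, hij⟩).2⟩ (h j hj)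
  refine Set.MapsTo.countable_of_injOn
    (f := fun i => {k | k ∈ S ∧ k < i}.ncard) (Set.mapsTo_univ _ _) ?_ Set.countable_univ
  intro i hi j hj hij
  rcases lt_trichotomy i j with hlt | heq | hgt
  · exact absurd hij (hmono i hi j hj hlt).ne
  · exact heq
  · exact absurd hij (hmono j hj i hi hgt).ne'

/-- The set of countable ordinals is uncountable. -/
theorem Ordinal.not_countable_Iio_ord_aleph_one :
    ¬ (Set.Iio (Cardinal.aleph 1).ord : Set Ordinal).Countable := by
  rw [← Cardinal.le_aleph0_iff_set_countable, Cardinal.mk_Iio_ordinal, Cardinal.card_ord,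
    Cardinal.lift_le_aleph0, not_le]
  exact Cardinal.aleph0_lt_aleph_one

theorem hausdorff_gap_not_split (a x : Ordinal → Set ℕ)
    (hgap : ∀ α β : Ordinal, α ≤ β → β < (Cardinal.aleph 1).ord →
      (a α \ a β).Finite ∧ x α ⊆ a α ∧ EqStar (x β ∩ a α) (x α))
    (hHaus : ∀ α : Ordinal, α < (Cardinal.aleph 1).ord → ∀ n : ℕ,
      {β : Ordinal | β < α ∧ x α ∩ (a β \ x β) ⊆ Set.Iio n}.Finite) :
    ¬ ∃ Y : Set ℕ, ∀ α : Ordinal, α < (Cardinal.aleph 1).ord →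
        EqStar (Y ∩ a α) (x α) := by
  rintro ⟨Y, hY⟩
  let S : ℕ → Set Ordinal := fun n => {α | α < (Cardinal.aleph 1).ord ∧
    ((Y ∩ a α) \ x α) ∪ (x α \ (Y ∩ a α)) ⊆ Set.Iio n}
  have hS : ∀ n, (S n).Countable := fun n => by
    refine Set.countable_of_finite_initial_segments fun α hα => (hHaus α hα.1 n).subset ?_
    rintro β ⟨hβ, hlt⟩
    refine ⟨hlt, ?_⟩
    rintro k ⟨hkα, hkβ, hkx⟩
    by_cases hkY : k ∈ Y
    · exact hβ.2 (Or.inl ⟨⟨hkY, hkβ⟩, hkx⟩)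
    · exact hα.2 (Or.inr ⟨hkα, fun hk => hkY hk.1⟩)
  refine Ordinal.not_countable_Iio_ord_aleph_one ((Set.countable_iUnion hS).mono fun α hα => ?_)
  obtain ⟨n, hn⟩ := (hY α hα).bddAbove
  exact Set.mem_iUnion.2 ⟨n + 1, hα, fun k hk => Nat.lt_succ_of_le (hn hk)⟩
end

section
/- Let a, b ⊆ ℕ and let g₁, g₂ : ℕ → ℕ be functions such that g₁ is injective on a, g₂ is injective on b, and for every y ⊆ a ∩ b one has g₁ '' y =* g₂ '' y. Then the set {n ∈ a ∩ b : g₁ n ≠ g₂ n} is finite. (Consequently, if F induces an automorphism of P(ω)/fin, any two functions witnessing membership of sets a, b in triv(F) agree on all but finitely many points of a ∩ b, so the family of trivializing functions is coherent.) -/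
/-- Two functions that are injective on an infinite set and differ at every point of it have
disjoint images on some infinite subset. -/
theorem exists_infinite_subset_disjoint_image {α β : Type*} {D : Set α} {g₁ g₂ : α → β}
    (hD : D.Infinite) (h₁ : Set.InjOn g₁ D) (h₂ : Set.InjOn g₂ D)
    (hne : ∀ n ∈ D, g₁ n ≠ g₂ n) :
    ∃ y ⊆ D, y.Infinite ∧ Disjoint (g₁ '' y) (g₂ '' y) := by
  have hfin : ∀ g : α → β, Set.InjOn g D → ∀ t : Set β, t.Finite → (D ∩ g ⁻¹' t).Finite :=
    fun g hg t ht => Set.Finite.of_finite_image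
      (ht.subset (Set.image_subset_iff.2 Set.inter_subset_right)) (hg.mono Set.inter_subset_left)
  let r : α → α → Prop := fun m n => m ≠ n ∧ g₁ m ≠ g₂ n ∧ g₂ m ≠ g₁ n
  have : Std.Symm r := ⟨fun m n h => ⟨h.1.symm, h.2.2.symm, h.2.1.symm⟩⟩
  obtain ⟨f, hfD, hf⟩ := exists_seq_of_forall_finset_exists' (· ∈ D) r (by
    intro s _
    obtain ⟨n, hn, hns⟩ := (hD.sdiff ((s.finite_toSet.union
      (hfin g₁ h₁ _ (s.finite_toSet.image g₂))).union
      (hfin g₂ h₂ _ (s.finite_toSet.image g₁)))).nonempty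
    simp only [Set.mem_union, not_or] at hns
    refine ⟨n, hn, fun m hm => ⟨?_, fun h => ?_, fun h => ?_⟩⟩
    · rintro rfl
      exact hns.1.1 hm
    · exact hns.2 ⟨hn, m, hm, h⟩
    · exact hns.1.2 ⟨hn, m, hm, h⟩)
  refine ⟨Set.range f, Set.range_subset_iff.2 hfD, Set.infinite_range_of_injective ?_, ?_⟩
  · intro i j hij
    by_contra h
    exact (hf h).1 hij
  · rw [Set.disjoint_left]
    rintro _ ⟨_, ⟨i, rfl⟩, rfl⟩ ⟨_, ⟨j, rfl⟩, hij⟩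
    rcases eq_or_ne i j with rfl | h
    · exact hne _ (hfD i) hij.symm
    · exact (hf h).2.1 hij.symm

theorem trivializing_functions_cohere (a b : Set ℕ) (g₁ g₂ : ℕ → ℕ)
    (h₁ : Set.InjOn g₁ a) (h₂ : Set.InjOn g₂ b)
    (hcoh : ∀ y : Set ℕ, y ⊆ a ∩ b → EqStar (g₁ '' y) (g₂ '' y)) :
    {n ∈ a ∩ b | g₁ n ≠ g₂ n}.Finite := by
  by_contra hD
  obtain ⟨y, hyD, hy, hdisj⟩ := exists_infinite_subset_disjoint_image hD
    (h₁.mono fun _ hn => hn.1.1) (h₂.mono fun _ hn => hn.1.2) fun _ hn => hn.2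
  have hfin : (g₁ '' y \ g₂ '' y).Finite :=
    (hcoh y fun _ hn => (hyD hn).1).subset Set.subset_union_left
  rw [hdisj.sdiff_eq_left] at hfin
  exact hy (hfin.of_finite_image (h₁.mono fun _ hn => (hyD hn).1.1))
end

section
/- Let H = ⟨h_α : α < ω₁⟩ be a family of partial functions from ℕ to ℕ indexed by the countable ordinals. For each n ∈ ℕ, the set D_n = {r ∈ Q(H) : n_r ≥ n} is dense in the poset Q(H): every condition q ∈ Q(H) has an extension r ≤ q with n_r ≥ n. -/
/-- The condition of height `N ≥ q.n` whose sets are constant above level `q.n`. -/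
def QCond.extend {H : Ordinal → Set ℕ × (ℕ → ℕ)} (q : QCond H) (N : ℕ) (hN : q.n ≤ N) :
    QCond H where
  n := N
  s ρ := q.s (ρ.take q.n)
  Γ := q.Γ
  gamma_lt := q.gamma_lt
  sep α hα β hβ hne ρ hρ := q.sep α hα β hβ hne (ρ.take q.n) (by simp [hρ, hN])
  mono ρ hρ j k hjk _ := by
    have h := q.mono (ρ.take q.n) (by simp [hρ, hN]) (min j q.n) (min k q.n) (by omega)
      (by omega)
    simpa [List.take_take, min_comm] using h
  inter ρ ψ hρ hψ j hj heq hsplit := by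
    rcases lt_or_ge j q.n with hlt | hge
    · have h := q.inter (ρ.take q.n) (ψ.take q.n) (by simp [hρ, hN]) (by simp [hψ, hN]) j
        hlt.le (by rwa [List.take_take, List.take_take, min_eq_left hlt.le])
        (Or.inr (by
          rw [List.take_take, List.take_take, min_eq_left (Nat.succ_le_of_lt hlt)]
          exact hsplit.resolve_left (by omega)))
      rw [h, List.take_take, List.take_take, min_comm]
    · have h : ρ.take q.n = ψ.take q.n := by
        have h := congrArg (List.take q.n) heq
        rwa [List.take_take, List.take_take, min_eq_left hge] at h
      rw [← h, Finset.inter_self, List.take_take, min_eq_left hge]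

/-- For each `n`, the set `D_n = {r ∈ Q(H) : n_r ≥ n}` is dense in `Q(H)`. -/
theorem QH_Dn_dense (H : Ordinal → Set ℕ × (ℕ → ℕ)) (n : ℕ) (q : QCond H) :
    ∃ r : QCond H, QLe r q ∧ n ≤ r.n := by
  refine ⟨q.extend (max n q.n) (le_max_right _ _),
    ⟨le_max_right _ _, Finset.Subset.refl _, fun ρ hρ => ?_⟩, le_max_left _ _⟩
  simp only [QCond.extend, List.take_of_length_le hρ]
end
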